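/- Let N ≥ 2 be an even integer and k = N/2. Let (v_j) ⊂ X_1 be a normalized concentrating sequence at the origin, i.e., ‖v_j‖_{X_1} = 1 for all j, v_j ⇀ 0 weakly in X_1 (meaning ∫₀¹ r^{N−k} |v_j'(r)|^{k−1} v_j'(r) g(r) dr → 0 for every measurable g with ∫₀¹ r^{N−k}|g(r)|^{(k+1)/k} dr < ∞), and lim_{j→∞} ∫_{r₀}¹ r^{N−k}|v_j'(r)|^{k+1} dr = 0 for every r₀ ∈ (0,1). Then limsup_{j→∞} ∫₀¹ r^{N−1} exp(μ_N |v_j(r)|^{(N+2)/N}) dr ≤ (1/N)·(1 + e^{H_k}), where H_k = ∑_{i=1}^{k} 1/i. -/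

import Mathlib

open MeasureTheory Real Set Filter
open scoped ENNReal

/-- Surface area of the unit sphere in `ℝ^N` (equals `N` times the volume of the unit ball). -/
noncomputable def omegaS (N : ℕ) : ℝ :=
  N * (volume (Metric.ball (0 : EuclideanSpace ℝ (Fin N)) 1)).toReal

/-- The normalising constant `c_N = ω_{N-1} · binom(N,k) / N`. -/
noncomputable def cN (N k : ℕ) : ℝ := omegaS N * (N.choose k) / N

/-- The critical constant `μ_N = N · (ω_{N-1} · binom(N-1,k-1) / k)^{2/N}`. -/
noncomputable def muN (N k : ℕ) : ℝ :=
  N * (omegaS N * ((N - 1).choose (k - 1)) / k) ^ ((2 : ℝ) / N)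

/-- Membership in the weighted space `X₁`: `v` is locally absolutely continuous on `(0,1)`
with derivative `v'` (in the sense of the fundamental theorem of calculus),
`v(r) → 0` as `r → 1⁻`, and the two defining weighted integrals are finite. -/
structure MemX1 (N k : ℕ) (v v' : ℝ → ℝ) : Prop where
  locAC : ∀ a ∈ Ioo (0:ℝ) 1, ∀ b ∈ Ioo (0:ℝ) 1,
    IntervalIntegrable v' volume a b ∧ v b - v a = ∫ t in a..b, v' t
  lim_one : Tendsto v (nhdsWithin 1 (Iio 1)) (nhds 0)
  grad_int : ∫⁻ r in Ioo (0:ℝ) 1, ENNReal.ofReal (r ^ (N - k) * |v' r| ^ (k + 1)) < ⊤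
  fun_int : ∫⁻ r in Ioo (0:ℝ) 1, ENNReal.ofReal (r ^ (N - 1) * |v r| ^ (k + 1)) < ⊤

/-- The norm on `X₁`: `‖v‖ = (c_N ∫₀¹ r^{N-k} |v'|^{k+1} dr)^{1/(k+1)}`. -/
noncomputable def normX1 (N k : ℕ) (v' : ℝ → ℝ) : ℝ :=
  (cN N k * ∫ r in Ioo (0:ℝ) 1, r ^ (N - k) * |v' r| ^ (k + 1)) ^ (1 / (k + 1 : ℝ))

/-- Weak convergence in `X₁` of the (nonlinear gradients of the) sequence `vj'` to `w'`:
tested against all `g` with `∫₀¹ r^{N-k} |g|^{(k+1)/k} dr < ∞`. -/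
def WeakConvX1 (N k : ℕ) (vj' : ℕ → ℝ → ℝ) (w' : ℝ → ℝ) : Prop :=
  ∀ g : ℝ → ℝ, Measurable g →
    (∫⁻ r in Ioo (0:ℝ) 1, ENNReal.ofReal (r ^ (N - k) * |g r| ^ ((k + 1 : ℝ) / k)) < ⊤) →
    Tendsto (fun j => ∫ r in Ioo (0:ℝ) 1, r ^ (N - k) * |vj' j r| ^ (k - 1) * vj' j r * g r)
      atTop (nhds (∫ r in Ioo (0:ℝ) 1, r ^ (N - k) * |w' r| ^ (k - 1) * w' r * g r))

/-- Weighted arithmetic-geometric mean inequality with natural exponents. -/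
lemma succ_mul_mul_pow_le (k : ℕ) {y q : ℝ} (hy : 0 ≤ y) (hq : 0 ≤ q) :
    (k + 1) * y * q ^ k ≤ y ^ (k + 1) + k * q ^ (k + 1) := by
  rcases hq.eq_or_lt with rfl | hq
  · rcases k.eq_zero_or_pos with rfl | hk
    · simp
    · simp [hk.ne']; positivity
  · have h := one_add_mul_sub_le_pow (a := y / q) (by have := div_nonneg hy hq.le; linarith) (k + 1)
    have h2 := mul_le_mul_of_nonneg_right h (pow_pos hq (k + 1)).le
    rw [div_pow, div_mul_cancel₀ _ (pow_pos hq (k + 1)).ne'] at h2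
    have h3 : (1 + ((k + 1 : ℕ) : ℝ) * (y / q - 1)) * q ^ (k + 1)
        = (k + 1) * y * q ^ k - k * q ^ (k + 1) := by
      push_cast; field_simp; ring
    linarith

/-- A continuous primitive of `g ↦ 1 + log (g - g ^ (1 + 1 / k))` on `[0, 1]`. -/
noncomputable def logPrimitive (k : ℕ) (g : ℝ) : ℝ :=
  g * log g
    - (∑ i ∈ Finset.range k, (g ^ (1 / k : ℝ)) ^ i)
      * ((1 - g ^ (1 / k : ℝ)) * log (1 - g ^ (1 / k : ℝ)))
    - ∑ i ∈ Finset.range k, (g ^ (1 / k : ℝ)) ^ (i + 1) / (i + 1)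

lemma continuous_logPrimitive (k : ℕ) : Continuous (logPrimitive k) := by
  have h1 : Continuous fun g : ℝ => g ^ (1 / k : ℝ) :=
    continuous_id.rpow_const fun x => Or.inr (by positivity)
  have h2 : Continuous fun g : ℝ => (1 - g ^ (1 / k : ℝ)) * log (1 - g ^ (1 / k : ℝ)) :=
    continuous_mul_log.comp (continuous_const.sub h1)
  unfold logPrimitive
  exact (continuous_mul_log.sub ((continuous_finsetSum _ fun i _ => h1.pow i).mul h2)).sub
    (continuous_finsetSum _ fun i _ => (h1.pow (i + 1)).div_const _)

lemma logPrimitive_zero {k : ℕ} (hk : 0 < k) : logPrimitive k 0 = 0 := by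
  simp [logPrimitive, hk.ne']

lemma logPrimitive_one (k : ℕ) :
    logPrimitive k 1 = -∑ i ∈ Finset.range k, (1 : ℝ) / (i + 1) := by
  simp [logPrimitive]

lemma rpow_one_div_natCast_pow {k : ℕ} (hk : 0 < k) {g : ℝ} (hg : 0 ≤ g) :
    (g ^ (1 / k : ℝ)) ^ k = g := by
  rw [one_div]; exact Real.rpow_inv_natCast_pow hg hk.ne'

lemma hasDerivAt_logPrimitive {k : ℕ} (hk : 0 < k) {g : ℝ} (h0 : 0 < g) (h1 : g < 1) :
    HasDerivAt (logPrimitive k) (1 + log g + log (1 - g ^ (1 / k : ℝ))) g := by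
  have hk' : (0 : ℝ) < k := by exact_mod_cast hk
  set Q : ℝ → ℝ := fun g => g ^ (1 / k : ℝ) with hQ
  have hq1 : Q g < 1 := Real.rpow_lt_one h0.le h1 (by positivity)
  obtain ⟨q', hq'⟩ : ∃ q', HasDerivAt Q q' g :=
    ⟨_, Real.hasDerivAt_rpow_const (Or.inl h0.ne')⟩
  have hgeom : ∀ x, 0 < x → (∑ i ∈ Finset.range k, Q x ^ i) * (1 - Q x) = 1 - x := by
    intro x hx
    have h := geom_sum_mul (Q x) k
    rw [rpow_one_div_natCast_pow hk hx.le] at h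
    linarith
  have heq : logPrimitive k =ᶠ[nhds g] fun x => x * log x - (1 - x) * log (1 - Q x)
      - ∑ i ∈ Finset.range k, Q x ^ (i + 1) / (i + 1) := by
    filter_upwards [eventually_gt_nhds h0] with x hx
    have := hgeom x hx
    simp only [logPrimitive]
    rw [← this]
    simp only [hQ]
    ring
  refine HasDerivAt.congr_of_eventuallyEq ?_ heq
  have hA : HasDerivAt (fun x : ℝ => x * log x) (log g + 1) g := Real.hasDerivAt_mul_log h0.ne'
  have hB : HasDerivAt (fun x => log (1 - Q x)) (-q' / (1 - Q g)) g := by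
    have := (hq'.const_sub 1).log (by linarith : 1 - Q g ≠ 0)
    simpa using this
  have hC : HasDerivAt (fun x => (1 - x) * log (1 - Q x))
      (-1 * log (1 - Q g) + (1 - g) * (-q' / (1 - Q g))) g := by
    exact ((hasDerivAt_id' g).const_sub 1).fun_mul hB
  have hD : HasDerivAt (fun x => ∑ i ∈ Finset.range k, Q x ^ (i + 1) / (i + 1))
      (∑ i ∈ Finset.range k, Q g ^ i * q') g := by
    have : ∀ i ∈ Finset.range k, HasDerivAt (fun x => Q x ^ (i + 1) / (i + 1 : ℝ))
        (Q g ^ i * q') g := by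
      intro i _
      have h := (hq'.pow (i + 1)).div_const (i + 1 : ℝ)
      have e : ((i + 1 : ℕ) : ℝ) * Q g ^ (i + 1 - 1) * q' / (i + 1 : ℝ) = Q g ^ i * q' := by
        have : (i + 1 : ℝ) ≠ 0 := by positivity
        rw [Nat.add_sub_cancel]
        push_cast
        field_simp
      rw [e] at h
      exact h
    exact HasDerivAt.fun_sum this
  refine ((hA.sub hC).sub hD).congr_deriv ?_
  rw [← Finset.sum_mul, ← hgeom g h0]
  have : 1 - Q g ≠ 0 := by linarith
  field_simp
  ring

/-- Integration by parts between a primitive vanishing at `a` and one vanishing at `b`. -/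
lemma integral_mul_primitive_eq {f ρ : ℝ → ℝ} {a b : ℝ}
    (hf : IntervalIntegrable f volume a b) (hρ : IntervalIntegrable ρ volume a b) :
    ∫ t in a..b, f t * (∫ s in t..b, ρ s) = ∫ t in a..b, (∫ s in a..t, f s) * ρ t := by
  have hF := hf.absolutelyContinuousOnInterval_intervalIntegral (c := a) left_mem_uIcc
  have hR := hρ.absolutelyContinuousOnInterval_intervalIntegral (c := b) right_mem_uIcc
  have h := hF.integral_mul_deriv_eq_deriv_mul hR
  have e1 : ∫ t in a..b, (∫ s in a..t, f s) * deriv (fun x => ∫ v in b..x, ρ v) t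
      = ∫ t in a..b, (∫ s in a..t, f s) * ρ t := by
    refine intervalIntegral.integral_congr_ae ?_
    filter_upwards [hρ.ae_hasDerivAt_integral] with x hx hx'
    rw [(hx (uIoc_subset_uIcc hx') b right_mem_uIcc).deriv]
  have e2 : ∫ t in a..b, deriv (fun x => ∫ v in a..x, f v) t * (∫ s in b..t, ρ s)
      = -∫ t in a..b, f t * (∫ s in t..b, ρ s) := by
    rw [← intervalIntegral.integral_neg]
    refine intervalIntegral.integral_congr_ae ?_
    filter_upwards [hf.ae_hasDerivAt_integral] with x hx hx'
    rw [(hx (uIoc_subset_uIcc hx') a left_mem_uIcc).deriv, intervalIntegral.integral_symm x b]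
    ring
  rw [e1, e2] at h
  simp at h
  linarith

/-- A sharp one-dimensional Onofri type inequality. -/
lemma mul_integral_exp_le {k : ℕ} (hk : 0 < k) {a b l : ℝ} (hab : a < b) (hl : 0 < l)
    {f : ℝ → ℝ} (hf0 : ∀ t, 0 ≤ f t) (hf : ∀ a b, IntervalIntegrable f volume a b)
    (hfp : IntervalIntegrable (fun t => f t ^ (k + 1)) volume a b) :
    l * ∫ t in a..b, exp ((∫ s in a..t, f s) - l * (t - a)) ≤
      exp ((k / (k + 1 : ℝ)) ^ k / (k + 1) / l ^ k * (∫ t in a..b, f t ^ (k + 1))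
        + ∑ i ∈ Finset.range k, (1 : ℝ) / (i + 1)) := by
  have hk' : (0 : ℝ) < k := by exact_mod_cast hk
  set u : ℝ → ℝ := fun t => ∫ s in a..t, f s with hu
  have huc : Continuous u := intervalIntegral.continuous_primitive hf a
  set e : ℝ → ℝ := fun t => exp (u t - l * (t - a)) with he
  have hec : Continuous e := by fun_prop
  set Z : ℝ := ∫ t in a..b, e t with hZ
  have hZ0 : 0 < Z := intervalIntegral.intervalIntegral_pos_of_pos_on
    (hec.intervalIntegrable _ _) (fun x _ => exp_pos _) hab
  set ρ : ℝ → ℝ := fun t => e t / Z with hρ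
  have hρ0 : ∀ t, 0 < ρ t := fun t => div_pos (exp_pos _) hZ0
  have hρc : Continuous ρ := hec.div_const _
  set G : ℝ → ℝ := fun t => ∫ s in t..b, ρ s with hG
  have hGd : ∀ t, HasDerivAt G (-ρ t) t := fun t =>
    intervalIntegral.integral_hasDerivAt_left (hρc.intervalIntegrable _ _)
      (hρc.stronglyMeasurableAtFilter _ _) hρc.continuousAt
  have hGc : Continuous G := continuous_iff_continuousAt.2 fun t => (hGd t).continuousAt
  have hGa : G a = 1 := by
    simp only [hG, hρ, intervalIntegral.integral_div]
    exact div_self hZ0.ne'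
  have hGb : G b = 0 := by simp [hG]
  have hGpos : ∀ t, t < b → 0 < G t := fun t ht =>
    intervalIntegral.intervalIntegral_pos_of_pos_on (hρc.intervalIntegrable _ _)
      (fun x _ => hρ0 x) ht
  have hG0 : ∀ t, t ≤ b → 0 ≤ G t := fun t ht => by
    rcases ht.eq_or_lt with rfl | h
    · exact hGb.ge
    · exact (hGpos t h).le
  have hG1 : ∀ t, a < t → G t < 1 := fun t ht => by
    have h1 : G a = (∫ s in a..t, ρ s) + G t :=
      (intervalIntegral.integral_add_adjacent_intervals (hρc.intervalIntegrable _ _)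
        (hρc.intervalIntegrable _ _)).symm
    have h2 : 0 < ∫ s in a..t, ρ s :=
      intervalIntegral.intervalIntegral_pos_of_pos_on (hρc.intervalIntegrable _ _)
        (fun x _ => hρ0 x) ht
    linarith
  set q : ℝ → ℝ := fun t => G t ^ (1 / k : ℝ) with hq
  have hqc : Continuous q := hGc.rpow_const fun x => Or.inr (by positivity)
  have hlogρ : ∀ t, log (ρ t) = u t - l * (t - a) - log Z := fun t => by
    simp only [hρ, he]
    rw [log_div (exp_pos _).ne' hZ0.ne', log_exp]
  -- the part of the estimate that is a total derivative
  set K : ℝ → ℝ := fun t =>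
    -(l * (t - a) * G t) - logPrimitive k (G t) - (log Z + log l) * G t with hK
  have hKint : K b - K a ≤ ∫ t in a..b, (u t * ρ t - l * (G t * q t)) := by
    have hKc : Continuous K := by
      have := (continuous_logPrimitive k).comp hGc
      simp only [hK]
      fun_prop
    refine intervalIntegral.sub_le_integral_of_hasDeriv_right_of_le hab.le hKc.continuousOn
      (g' := fun t => -(l * G t - l * (t - a) * ρ t)
        + (1 + log (G t) + log (1 - q t)) * ρ t + (log Z + log l) * ρ t) ?_ ?_ ?_
    · intro t ht
      refine HasDerivAt.hasDerivWithinAt ?_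
      have h1 := ((((hasDerivAt_id t).sub_const a).const_mul l).mul (hGd t)).neg
      have h2 := (hasDerivAt_logPrimitive hk (hGpos t ht.2) (hG1 t ht.1)).comp t (hGd t)
      have h3 := (hGd t).const_mul (log Z + log l)
      refine ((h1.sub h2).sub h3).congr_deriv ?_
      simp only [hq, id]
      ring
    · exact (Continuous.integrableOn_Icc (by fun_prop))
    · intro t ht
      have g0 := hGpos t ht.2
      have g1 := hG1 t ht.1
      have q1 : q t < 1 := Real.rpow_lt_one g0.le g1 (by positivity)
      have hx : 0 < l * (G t * (1 - q t)) := by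
        have : 0 < 1 - q t := by linarith
        positivity
      have hlog : log (l * (G t * (1 - q t)) / ρ t) ≤ l * (G t * (1 - q t)) / ρ t - 1 :=
        log_le_sub_one_of_pos (div_pos hx (hρ0 t))
      have q2 : 1 - q t ≠ 0 := by linarith
      rw [log_div hx.ne' (hρ0 t).ne', log_mul hl.ne' (by positivity), log_mul g0.ne' q2,
        hlogρ] at hlog
      have := mul_le_mul_of_nonneg_right hlog (hρ0 t).le
      rw [sub_mul (_ / _) 1, div_mul_cancel₀ _ (hρ0 t).ne'] at this
      nlinarith [this]
  have hYoung : ∀ t ∈ Icc a b, f t * G t - l * (G t * q t) ≤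
      (k / (k + 1 : ℝ)) ^ k / (k + 1) / l ^ k * f t ^ (k + 1) := by
    intro t ht
    have hg0 := hG0 t ht.2
    have hq0 : 0 ≤ q t := Real.rpow_nonneg hg0 _
    have hqk : G t = q t ^ k := (rpow_one_div_natCast_pow hk hg0).symm
    have h := succ_mul_mul_pow_le k (y := k * f t / ((k + 1) * l)) (q := q t)
      (by have := hf0 t; positivity) hq0
    rw [hqk]
    have h2 := mul_le_mul_of_nonneg_left h (by positivity : 0 ≤ l / k)
    have e1 : l / k * ((k + 1) * (k * f t / ((k + 1) * l)) * q t ^ k) = f t * q t ^ k := by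
      field_simp
    have e2 : l / k * ((k * f t / ((k + 1) * l)) ^ (k + 1) + k * q t ^ (k + 1))
        = (k / (k + 1 : ℝ)) ^ k / (k + 1) / l ^ k * f t ^ (k + 1) + l * (q t ^ k * q t) := by
      rw [div_pow, div_pow, mul_pow, mul_pow]
      field_simp
      ring
    rw [e1, e2] at h2
    linarith
  have hint : ∫ t in a..b, (f t * G t - l * (G t * q t)) ≤
      (k / (k + 1 : ℝ)) ^ k / (k + 1) / l ^ k * ∫ t in a..b, f t ^ (k + 1) := by
    rw [← intervalIntegral.integral_const_mul]
    refine intervalIntegral.integral_mono_on hab.le ?_ (hfp.const_mul _) hYoung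
    exact ((hf a b).mul_continuousOn hGc.continuousOn).sub
      (Continuous.intervalIntegrable (by fun_prop) _ _)
  have huρ : Continuous fun t => u t * ρ t := huc.mul hρc
  have hparts : ∫ t in a..b, f t * G t = ∫ t in a..b, u t * ρ t :=
    integral_mul_primitive_eq (hf a b) (hρc.intervalIntegrable a b)
  rw [intervalIntegral.integral_sub ((hf a b).mul_continuousOn hGc.continuousOn)
    (Continuous.intervalIntegrable (by fun_prop) _ _), hparts,
    ← intervalIntegral.integral_sub (huρ.intervalIntegrable _ _)
    (Continuous.intervalIntegrable (by fun_prop) _ _)] at hint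
  have hfin := hKint.trans hint
  simp only [hK, hGa, hGb, logPrimitive_zero hk, logPrimitive_one] at hfin
  rw [← Real.log_le_iff_le_exp (by positivity), log_mul hl.ne' hZ0.ne']
  linarith

/-- Hölder's inequality for the primitive of a function with integrable `(k + 1)`-st power. -/
lemma integral_pow_succ_le {k : ℕ} {a b : ℝ} (hab : a ≤ b)
    {f : ℝ → ℝ} (hf0 : ∀ t, 0 ≤ f t) (hf : IntervalIntegrable f volume a b)
    (hfp : IntervalIntegrable (fun t => f t ^ (k + 1)) volume a b) :
    (∫ t in a..b, f t) ^ (k + 1) ≤ (b - a) ^ k * ∫ t in a..b, f t ^ (k + 1) := by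
  rcases hab.eq_or_lt with rfl | hlt
  · simp
  have hba : 0 < b - a := sub_pos.2 hlt
  set I := ∫ t in a..b, f t with hI
  have hI0 : 0 ≤ I := intervalIntegral.integral_nonneg hab fun t _ => hf0 t
  have h1 : ∫ t in a..b, ((k + 1) * (I / (b - a)) ^ k * f t - k * (I / (b - a)) ^ (k + 1)) ≤
      ∫ t in a..b, f t ^ (k + 1) := by
    refine intervalIntegral.integral_mono_on hab
      ((hf.const_mul _).sub intervalIntegrable_const) hfp fun t _ => ?_
    have := succ_mul_mul_pow_le k (hf0 t) (div_nonneg hI0 hba.le)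
    linarith
  rw [intervalIntegral.integral_sub (hf.const_mul _) intervalIntegrable_const,
    intervalIntegral.integral_const_mul, intervalIntegral.integral_const, ← hI, smul_eq_mul] at h1
  have h2 := mul_le_mul_of_nonneg_left h1 (pow_pos hba k).le
  have e : (b - a) ^ k * ((k + 1) * (I / (b - a)) ^ k * I
      - (b - a) * (k * (I / (b - a)) ^ (k + 1))) = I ^ (k + 1) := by
    rw [div_pow, div_pow]
    field_simp
    ring
  rwa [e] at h2

lemma rpow_one_add_one_div_pow {k : ℕ} (hk : 0 < k) {x : ℝ} (hx : 0 ≤ x) :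
    (x ^ (1 + 1 / k : ℝ)) ^ k = x ^ (k + 1) := by
  rw [← Real.rpow_natCast, ← Real.rpow_mul hx, ← Real.rpow_natCast]
  congr 1
  have : (k : ℝ) ≠ 0 := by positivity
  push_cast
  field_simp

lemma integral_rpow_le {k : ℕ} (hk : 0 < k) {a b δ : ℝ} (hab : a ≤ b)
    {f : ℝ → ℝ} (hf0 : ∀ t, 0 ≤ f t) (hf : IntervalIntegrable f volume a b)
    (hfp : IntervalIntegrable (fun t => f t ^ (k + 1)) volume a b)
    (hδ : ∫ t in a..b, f t ^ (k + 1) ≤ δ) :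
    (∫ t in a..b, f t) ^ (1 + 1 / k : ℝ) ≤ (b - a) * δ ^ (1 / k : ℝ) := by
  have hI0 : 0 ≤ ∫ t in a..b, f t := intervalIntegral.integral_nonneg hab fun t _ => hf0 t
  have hE0 : 0 ≤ ∫ t in a..b, f t ^ (k + 1) :=
    intervalIntegral.integral_nonneg hab fun t _ => pow_nonneg (hf0 t) _
  have hba := sub_nonneg.2 hab
  refine le_of_pow_le_pow_left₀ hk.ne' (by have := hE0.trans hδ; positivity) ?_
  rw [rpow_one_add_one_div_pow hk hI0, mul_pow, rpow_one_div_natCast_pow hk (hE0.trans hδ)]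
  exact (integral_pow_succ_le hab hf0 hf hfp).trans
    (mul_le_mul_of_nonneg_left hδ (pow_nonneg hba k))

/-- Expansion of `(W + h) ^ (1 + s)` for `0 ≤ s ≤ 1`. -/
lemma add_rpow_one_add_le {s W h : ℝ} (hs0 : 0 ≤ s) (hs : s ≤ 1) (hW : 0 ≤ W) (hh : 0 ≤ h) :
    (W + h) ^ (1 + s) ≤ W ^ (1 + s) + (1 + s) * W ^ s * h + h ^ (1 + s) := by
  have hd : ∀ x ∈ Ici (0 : ℝ), HasDerivAt
      (fun x : ℝ => W ^ (1 + s) + (1 + s) * W ^ s * x + x ^ (1 + s) - (W + x) ^ (1 + s))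
      ((1 + s) * W ^ s + (1 + s) * x ^ s - (1 + s) * (W + x) ^ s) x := by
    intro x _
    have h1 := Real.hasDerivAt_rpow_const (x := x) (p := 1 + s) (Or.inr (by linarith))
    have h2 := ((hasDerivAt_id' x).const_add W).rpow_const (p := 1 + s) (Or.inr (by linarith))
    have h3 := (((hasDerivAt_id' x).const_mul ((1 + s) * W ^ s)).const_add (W ^ (1 + s)))
    refine ((h3.fun_add h1).fun_sub h2).congr_deriv ?_
    simp
  have hmono : MonotoneOn
      (fun x : ℝ => W ^ (1 + s) + (1 + s) * W ^ s * x + x ^ (1 + s) - (W + x) ^ (1 + s))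
      (Ici 0) := by
    refine monotoneOn_of_deriv_nonneg (convex_Ici 0)
      (fun x hx => (hd x hx).continuousAt.continuousWithinAt)
      (fun x hx => (hd x (interior_subset hx)).differentiableAt.differentiableWithinAt) ?_
    intro x hx
    have hx := interior_subset hx
    rw [(hd x hx).deriv]
    have := Real.rpow_add_le_add_rpow hW hx hs0 hs
    nlinarith
  have h0 := hmono (mem_Ici.2 le_rfl) (mem_Ici.2 hh) hh
  have hz : (0 : ℝ) ^ (1 + s) = 0 := Real.zero_rpow (by linarith)
  simp only [hz, mul_zero, add_zero, sub_self] at h0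
  linarith

/-- Estimate of the exponential integral beyond a point `a`, after which little energy is left. -/
lemma integral_exp_tail_le {k : ℕ} (hk : 0 < k) {a b δ : ℝ} (ha : 0 ≤ a) (hab : a < b)
    {f : ℝ → ℝ} (hf0 : ∀ t, 0 ≤ f t) (hf : ∀ a b, IntervalIntegrable f volume a b)
    (hfp : ∀ a b, IntervalIntegrable (fun t => f t ^ (k + 1)) volume a b)
    (hδ : ∫ t in a..b, f t ^ (k + 1) ≤ δ) (hδ1 : δ ^ (1 / k : ℝ) < 1) :
    ∫ t in a..b, exp ((∫ s in 0..t, f s) ^ (1 + 1 / k : ℝ) - t) ≤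
      (1 - δ ^ (1 / k : ℝ))⁻¹ * exp ((∫ s in 0..a, f s) ^ (1 + 1 / k : ℝ) - a
        + (∫ s in 0..a, f s) ^ (1 + 1 / k : ℝ) * δ / k / (1 - δ ^ (1 / k : ℝ)) ^ k
        + ∑ i ∈ Finset.range k, (1 : ℝ) / (i + 1)) := by
  have hk' : (0 : ℝ) < k := by exact_mod_cast hk
  have hk1 : (1 : ℝ) ≤ k := by exact_mod_cast hk
  have hF : Continuous fun t => ∫ s in 0..t, f s := intervalIntegral.continuous_primitive hf 0
  have hFa : Continuous fun t => ∫ s in a..t, f s := intervalIntegral.continuous_primitive hf a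
  set W := ∫ s in 0..a, f s with hW
  have hW0 : 0 ≤ W := intervalIntegral.integral_nonneg ha fun t _ => hf0 t
  set l := 1 - δ ^ (1 / k : ℝ) with hl
  have hl0 : 0 < l := by simp only [hl]; linarith
  set c := (1 + 1 / k : ℝ) * W ^ (1 / k : ℝ) with hc
  have hc0 : 0 ≤ c := by positivity
  set X := W ^ (1 + 1 / k : ℝ) with hX
  have hcX : (k / (k + 1 : ℝ)) ^ k / (k + 1) * c ^ (k + 1) = X / k := by
    have e : (W ^ (1 / k : ℝ)) ^ (k + 1) = X := by
      rw [hX, ← Real.rpow_natCast, ← Real.rpow_mul hW0]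
      congr 1
      push_cast
      field_simp
    have e2 : (1 + 1 / k : ℝ) = (k + 1) / k := by field_simp
    rw [hc, mul_pow, e, e2, div_pow, div_pow]
    field_simp
    ring
  have hcf := mul_integral_exp_le hk hab hl0 (f := fun t => c * f t)
    (fun t => mul_nonneg hc0 (hf0 t)) (fun a b => (hf a b).const_mul c)
    (by simpa only [mul_pow] using (hfp a b).const_mul (c ^ (k + 1)))
  simp only [mul_pow, intervalIntegral.integral_const_mul] at hcf
  have hpt : ∫ t in a..b, exp ((∫ s in 0..t, f s) ^ (1 + 1 / k : ℝ) - t) ≤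
      ∫ t in a..b, exp (X - a) * exp (c * (∫ s in a..t, f s) - l * (t - a)) := by
    refine intervalIntegral.integral_mono_on hab.le ?_ ?_ ?_
    · refine Continuous.intervalIntegrable ?_ _ _
      exact ((hF.rpow_const fun x => Or.inr (by positivity)).sub continuous_id).rexp
    · exact Continuous.intervalIntegrable (by fun_prop) _ _
    · intro t ht
      rw [← exp_add]
      refine exp_le_exp.2 ?_
      have hsplit : ∫ s in 0..t, f s = W + ∫ s in a..t, f s :=
        (intervalIntegral.integral_add_adjacent_intervals (hf _ _) (hf _ _)).symm
      have hh0 : 0 ≤ ∫ s in a..t, f s := intervalIntegral.integral_nonneg ht.1 fun t _ => hf0 t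
      have h1 := add_rpow_one_add_le (s := 1 / k) (by positivity)
        ((div_le_one hk').2 hk1) hW0 hh0
      have hle : ∫ s in a..t, f s ^ (k + 1) ≤ δ := by
        refine le_trans ?_ hδ
        exact intervalIntegral.integral_mono_interval le_rfl ht.1 ht.2
          (ae_of_all _ fun s => pow_nonneg (hf0 s) _) (hfp _ _)
      have h2 := integral_rpow_le hk ht.1 hf0 (hf _ _) (hfp _ _) hle
      rw [hsplit]
      have e : (1 + 1 / k : ℝ) * W ^ (1 / k : ℝ) * (∫ s in a..t, f s) = c * ∫ s in a..t, f s := rfl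
      simp only [hl]
      linarith
  rw [intervalIntegral.integral_const_mul] at hpt
  refine hpt.trans ?_
  rw [le_inv_mul_iff₀ hl0, ← mul_assoc, mul_comm l, mul_assoc, add_assoc, exp_add]
  refine mul_le_mul_of_nonneg_left (hcf.trans (exp_le_exp.2 ?_)) (exp_pos _).le
  gcongr
  calc (k / (k + 1 : ℝ)) ^ k / (k + 1) / l ^ k * (c ^ (k + 1) * ∫ t in a..b, f t ^ (k + 1))
      = ((k / (k + 1 : ℝ)) ^ k / (k + 1) * c ^ (k + 1)) / l ^ k * ∫ t in a..b, f t ^ (k + 1) := by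
        ring
    _ ≤ ((k / (k + 1 : ℝ)) ^ k / (k + 1) * c ^ (k + 1)) / l ^ k * δ := by gcongr
    _ = X * δ / k / l ^ k := by rw [hcX]; ring

lemma tendsto_rpow_two_mul_log_div {k : ℕ} (hk : 0 < k) (m : ℕ) :
    Tendsto (fun a : ℝ => log a ^ m * (k * (2 * log a) / a) ^ (1 / k : ℝ)) atTop (nhds 0) := by
  have hk' : (0 : ℝ) < k := by exact_mod_cast hk
  have h1 : Tendsto (fun a : ℝ => 2 * k * (log a ^ (m * k + 1) / a)) atTop (nhds 0) := by
    simpa using (isLittleO_pow_log_id_atTop (n := m * k + 1)).tendsto_div_nhds_zero.const_mul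
      (2 * k : ℝ)
  have h2 := h1.rpow_const (p := (1 / k : ℝ)) (Or.inr (by positivity))
  rw [Real.zero_rpow (by positivity)] at h2
  refine h2.congr' ?_
  filter_upwards [eventually_ge_atTop 1] with a ha
  have hl := log_nonneg ha
  have e : 2 * k * (log a ^ (m * k + 1) / a) = (log a ^ m) ^ k * (k * (2 * log a) / a) := by
    rw [← pow_mul]; ring
  rw [e, Real.mul_rpow (by positivity) (by positivity), one_div,
    Real.pow_rpow_inv_natCast (by positivity) hk.ne']

/-- The bound for the concentrated part is asymptotically sharp. -/
lemma tendsto_concentration_bound {k : ℕ} (hk : 0 < k) (H : ℝ) :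
    Tendsto (fun a : ℝ => (1 - (k * (2 * log a) / a) ^ (1 / k : ℝ))⁻¹ *
      exp (2 * log a * (((1 - (k * (2 * log a) / a) ^ (1 / k : ℝ)) ^ k)⁻¹ - 1) + H))
      atTop (nhds (exp H)) := by
  set η : ℝ → ℝ := fun a => (k * (2 * log a) / a) ^ (1 / k : ℝ) with hη
  have h0 : Tendsto η atTop (nhds 0) := by
    simpa only [pow_zero, one_mul] using tendsto_rpow_two_mul_log_div hk 0
  have h1 : Tendsto (fun a => log a * η a) atTop (nhds 0) := by
    simpa only [pow_one] using tendsto_rpow_two_mul_log_div hk 1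
  have hd : DifferentiableAt ℝ (fun y : ℝ => ((1 - y) ^ k)⁻¹) 0 :=
    DifferentiableAt.fun_inv (by fun_prop) (by simp)
  have hO := (hd.hasDerivAt.isBigO_sub).comp_tendsto h0
  have hO2 := (Asymptotics.isBigO_refl (fun a : ℝ => log a) atTop).mul hO
  have h2 := (hO2.trans_tendsto (by simpa using h1)).const_mul 2
  have h3 : Tendsto (fun a => (1 - η a)⁻¹) atTop (nhds 1) := by
    simpa using (h0.const_sub 1).inv₀ (by norm_num)
  have h4 := h3.mul ((h2.add_const H).rexp)
  simp only [mul_zero, zero_add, one_mul] at h4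
  refine h4.congr fun a => ?_
  simp [hη, mul_assoc]

/-- Estimate beyond a point where the primitive is close to the critical growth. -/
lemma integral_exp_le_of_critical {k : ℕ} (hk : 0 < k) {a b : ℝ} (ha : 1 ≤ a) (hab : a ≤ b)
    (hη : (k * (2 * log a) / a) ^ (1 / k : ℝ) < 1)
    {f : ℝ → ℝ} (hf0 : ∀ t, 0 ≤ f t) (hf : ∀ a b, IntervalIntegrable f volume a b)
    (hfp : ∀ a b, IntervalIntegrable (fun t => f t ^ (k + 1)) volume a b)
    (hE : ∫ t in 0..b, f t ^ (k + 1) ≤ 1)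
    (hcrit : a - 2 * log a ≤ (∫ s in 0..a, f s) ^ (1 + 1 / k : ℝ)) :
    ∫ t in a..b, exp ((∫ s in 0..t, f s) ^ (1 + 1 / k : ℝ) - t) ≤
      (1 - (k * (2 * log a) / a) ^ (1 / k : ℝ))⁻¹ *
      exp (2 * log a * (((1 - (k * (2 * log a) / a) ^ (1 / k : ℝ)) ^ k)⁻¹ - 1)
        + ∑ i ∈ Finset.range k, (1 : ℝ) / (i + 1)) := by
  have hk' : (0 : ℝ) < k := by exact_mod_cast hk
  have ha0 : 0 < a := by linarith
  set η := (k * (2 * log a) / a) ^ (1 / k : ℝ) with hηdef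
  have hη0 : 0 ≤ η := by have := log_nonneg ha; positivity
  have hl0 : 0 < 1 - η := by linarith
  rcases hab.eq_or_lt with rfl | hlt
  · rw [intervalIntegral.integral_same]; positivity
  set W := ∫ s in 0..a, f s with hW
  have hW0 : 0 ≤ W := intervalIntegral.integral_nonneg ha0.le fun t _ => hf0 t
  set X := W ^ (1 + 1 / k : ℝ) with hX
  have hX0 : 0 ≤ X := by positivity
  have hadd : (∫ t in 0..a, f t ^ (k + 1)) + ∫ t in a..b, f t ^ (k + 1) ≤ 1 := by
    rwa [intervalIntegral.integral_add_adjacent_intervals (hfp _ _) (hfp _ _)]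
  have hEab0 : 0 ≤ ∫ t in a..b, f t ^ (k + 1) :=
    intervalIntegral.integral_nonneg hab fun t _ => pow_nonneg (hf0 t) _
  have hXa : X ≤ a := by
    have := integral_rpow_le hk ha0.le hf0 (hf _ _) (hfp _ _)
      (by linarith : ∫ t in 0..a, f t ^ (k + 1) ≤ 1)
    simpa only [Real.one_rpow, sub_zero, mul_one] using this
  set δ := k * (a - X) / a with hδ
  have hδ0 : 0 ≤ δ := by have := sub_nonneg.2 hXa; positivity
  have hE1 : (X / a) ^ k ≤ ∫ t in 0..a, f t ^ (k + 1) := by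
    rw [div_pow, hX, rpow_one_add_one_div_pow hk hW0, div_le_iff₀' (by positivity)]
    simpa using integral_pow_succ_le ha0.le hf0 (hf 0 a) (hfp _ _)
  have hE2 : ∫ t in a..b, f t ^ (k + 1) ≤ δ := by
    have hB := one_add_mul_sub_le_pow (a := X / a) (by have := div_nonneg hX0 ha0.le; linarith) k
    have e : (k : ℝ) * (X / a - 1) = -δ := by rw [hδ]; field_simp; ring
    rw [e] at hB
    linarith
  have hδη : δ ^ (1 / k : ℝ) ≤ η := by
    refine Real.rpow_le_rpow hδ0 ?_ (by positivity)
    have : a - X ≤ 2 * log a := by linarith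
    exact div_le_div_of_nonneg_right (mul_le_mul_of_nonneg_left this hk'.le) ha0.le
  refine (integral_exp_tail_le hk ha0.le hlt hf0 hf hfp hE2 (hδη.trans_lt hη)).trans ?_
  have hXδ : X * δ / k ≤ a - X := by
    have : X * δ / k = (a - X) * (X / a) := by rw [hδ]; field_simp
    rw [this]
    exact mul_le_of_le_one_right (by linarith) ((div_le_one ha0).2 hXa)
  have hone : 1 ≤ ((1 - η) ^ k)⁻¹ :=
    (one_le_inv₀ (by positivity)).2 (pow_le_one₀ hl0.le (by linarith))
  gcongr
  calc X - a + X * δ / k / (1 - δ ^ (1 / k : ℝ)) ^ k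
      ≤ X - a + (a - X) / (1 - η) ^ k := by
        have : 0 ≤ a - X := by linarith
        gcongr
    _ = (a - X) * (((1 - η) ^ k)⁻¹ - 1) := by rw [div_eq_mul_inv]; ring
    _ ≤ 2 * log a * (((1 - η) ^ k)⁻¹ - 1) := by
        gcongr
        linarith

/-- First time in `[A, b]` at which a continuous function reaches another one, if any. -/
lemma exists_first_crossing {φ ψ : ℝ → ℝ} {A b : ℝ} (hAb : A ≤ b)
    (hφ : ContinuousOn φ (Icc A b)) (hψ : ContinuousOn ψ (Icc A b)) :
    ∃ a ∈ Icc A b, (∀ t ∈ Ico A a, φ t < ψ t) ∧ (a = b ∨ ψ a ≤ φ a) := by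
  set S := {t ∈ Icc A b | ψ t ≤ φ t} with hS
  rcases S.eq_empty_or_nonempty with h | h
  · refine ⟨b, right_mem_Icc.2 hAb, fun t ht => ?_, Or.inl rfl⟩
    by_contra! hc
    have : t ∈ S := ⟨Ico_subset_Icc_self ht, hc⟩
    simp [h] at this
  · have hcl : IsClosed S := isClosed_Icc.isClosed_le hψ hφ
    have hbdd : BddBelow S := ⟨A, fun t ht => ht.1.1⟩
    have hmem := hcl.csInf_mem h hbdd
    refine ⟨sInf S, hmem.1, fun t ht => ?_, Or.inr hmem.2⟩
    by_contra! hc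
    exact absurd (csInf_le hbdd ⟨⟨ht.1, ht.2.le.trans hmem.1.2⟩, hc⟩) (not_le.2 ht.2)

/-- Quantitative Carleson-Chang estimate: if almost no energy is spent near the origin, the
critical exponential integral is at most slightly larger than `1 + exp H_k`. -/
theorem exists_integral_exp_le {k : ℕ} (hk : 0 < k) {ε : ℝ} (hε : 0 < ε) :
    ∃ A > (0 : ℝ), ∃ σ > (0 : ℝ), ∀ f : ℝ → ℝ, (∀ t, 0 ≤ f t) →
      (∀ a b, IntervalIntegrable f volume a b) →
      (∀ a b, IntervalIntegrable (fun t => f t ^ (k + 1)) volume a b) →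
      (∀ b, 0 ≤ b → ∫ t in 0..b, f t ^ (k + 1) ≤ 1) →
      ∫ t in 0..A, f t ^ (k + 1) ≤ σ → ∀ b, A ≤ b →
      ∫ t in 0..b, exp ((∫ s in 0..t, f s) ^ (1 + 1 / k : ℝ) - t) ≤
        1 + exp (∑ i ∈ Finset.range k, (1 : ℝ) / (i + 1)) + ε := by
  set H := ∑ i ∈ Finset.range k, (1 : ℝ) / (i + 1) with hH
  have hk' : (0 : ℝ) < k := by exact_mod_cast hk
  have hev1 := (tendsto_concentration_bound hk H).eventually_lt_const
    (show exp H < exp H + ε / 3 by linarith)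
  have hev2 := (tendsto_rpow_two_mul_log_div hk 0).eventually_lt_const one_pos
  have hev3 := (tendsto_inv_atTop_zero (𝕜 := ℝ)).eventually_lt_const (show 0 < ε / 3 by positivity)
  obtain ⟨A, hA⟩ := eventually_atTop.1
    (hev1.and (hev2.and (hev3.and (eventually_ge_atTop (1 : ℝ)))))
  have hA1 : 1 ≤ A := (hA A le_rfl).2.2.2
  have hA0 : 0 < A := by linarith
  have hσ : ∃ σ > (0 : ℝ), exp (A * σ ^ (1 / k : ℝ)) ≤ 1 + ε / 3 := by
    have hc : Tendsto (fun σ : ℝ => exp (A * σ ^ (1 / k : ℝ))) (nhds 0) (nhds 1) := by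
      have : Continuous fun σ : ℝ => exp (A * σ ^ (1 / k : ℝ)) :=
        (continuous_const.mul (continuous_id.rpow_const fun x => Or.inr (by positivity))).rexp
      simpa [Real.zero_rpow, hk.ne'] using this.tendsto 0
    have h := (hc.eventually_lt_const (show (1 : ℝ) < 1 + ε / 3 by linarith)).filter_mono
      (nhdsWithin_le_nhds (s := Ioi 0))
    obtain ⟨σ, h1, h2⟩ := (h.and self_mem_nhdsWithin).exists
    exact ⟨σ, h2, h1.le⟩
  obtain ⟨σ, hσ0, hσ⟩ := hσ
  refine ⟨A, hA0, σ, hσ0, fun f hf0 hf hfp hE hEA b hb => ?_⟩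
  set φ : ℝ → ℝ := fun t => (∫ s in 0..t, f s) ^ (1 + 1 / k : ℝ) with hφ
  have hφc : Continuous φ :=
    (intervalIntegral.continuous_primitive hf 0).rpow_const fun x => Or.inr (by positivity)
  have hint : ∀ a b, IntervalIntegrable (fun t => exp (φ t - t)) volume a b := fun a b =>
    Continuous.intervalIntegrable (by fun_prop) _ _
  have hlogc : ∀ x, ContinuousOn (fun t => t - 2 * log t) (Icc A x) := fun x =>
    continuousOn_id.sub (continuousOn_const.mul
      (continuousOn_log.mono fun t ht => (hA0.trans_le ht.1).ne'))
  obtain ⟨a, ha, hlt, hcrit⟩ := exists_first_crossing hb hφc.continuousOn (hlogc b)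
  have hfirst : ∫ t in 0..A, exp (φ t - t) ≤ 1 + ε / 3 := by
    have h1 : ∫ t in 0..A, exp (φ t - t) ≤ ∫ t in 0..A, (1 + ε / 3) * exp (-t) := by
      refine intervalIntegral.integral_mono_on hA0.le (hint _ _)
        (Continuous.intervalIntegrable (by fun_prop) _ _) fun t ht => ?_
      rw [sub_eq_add_neg, exp_add]
      refine mul_le_mul_of_nonneg_right ((exp_le_exp.2 ?_).trans hσ) (exp_pos _).le
      have hle : ∫ s in 0..t, f s ^ (k + 1) ≤ σ := by
        refine le_trans ?_ hEA
        exact intervalIntegral.integral_mono_interval le_rfl ht.1 ht.2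
          (ae_of_all _ fun s => pow_nonneg (hf0 s) _) (hfp _ _)
      refine (integral_rpow_le hk ht.1 hf0 (hf _ _) (hfp _ _) hle).trans ?_
      have := ht.2
      rw [sub_zero]
      gcongr
    refine h1.trans ?_
    rw [intervalIntegral.integral_const_mul]
    refine mul_le_of_le_one_right (by positivity) ?_
    rw [intervalIntegral.integral_comp_neg (fun x => exp x), integral_exp]
    have := exp_pos (-A)
    simp only [neg_zero, exp_zero]
    linarith
  have hsecond : ∫ t in A..a, exp (φ t - t) ≤ ε / 3 := by
    have hderiv : ∀ t ∈ uIcc A a, HasDerivAt (fun t : ℝ => -t⁻¹) ((t ^ 2)⁻¹) t := by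
      intro t ht
      rw [uIcc_of_le ha.1] at ht
      have := (hasDerivAt_inv (hA0.trans_le ht.1).ne').fun_neg
      simpa using this
    have hsq : IntervalIntegrable (fun t : ℝ => (t ^ 2)⁻¹) volume A a := by
      refine ContinuousOn.intervalIntegrable ?_
      rw [uIcc_of_le ha.1]
      exact (continuousOn_pow 2).inv₀ fun t ht => pow_ne_zero 2 (hA0.trans_le ht.1).ne'
    have h1 : ∫ t in A..a, exp (φ t - t) ≤ ∫ t in A..a, (t ^ 2)⁻¹ := by
      refine intervalIntegral.integral_mono_on_of_le_Ioo ha.1 (hint _ _) hsq fun t ht => ?_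
      have ht0 : 0 < t := hA0.trans ht.1
      have := hlt t ⟨ht.1.le, ht.2⟩
      calc exp (φ t - t) ≤ exp (-log (t ^ 2)) := by
            refine exp_le_exp.2 ?_
            rw [log_pow]
            push_cast
            linarith
        _ = (t ^ 2)⁻¹ := by rw [exp_neg, exp_log (by positivity)]
    rw [intervalIntegral.integral_eq_sub_of_hasDerivAt hderiv hsq] at h1
    have h2 := (hA A le_rfl).2.2.1
    have h3 : 0 < a⁻¹ := inv_pos.2 (hA0.trans_le ha.1)
    linarith
  have hthird : ∫ t in a..b, exp (φ t - t) ≤ exp H + ε / 3 := by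
    rcases hcrit with rfl | hcrit
    · rw [intervalIntegral.integral_same]; positivity
    · obtain ⟨h1, h2, -, h4⟩ := hA a ha.1
      rw [pow_zero, one_mul] at h2
      exact (integral_exp_le_of_critical hk h4 ha.2 h2 hf0 hf hfp (hE b (hA0.le.trans hb))
        hcrit).trans h1.le
  rw [← intervalIntegral.integral_add_adjacent_intervals (hint 0 A) (hint A b),
    ← intervalIntegral.integral_add_adjacent_intervals (hint A a) (hint a b)]
  linarith

/-- The substitution `t ↦ e^{-t/n}` maps `(0, b)` onto `(e^{-b/n}, 1)`. -/
lemma image_exp_neg_div_Ioo {n : ℝ} (hn : 0 < n) (b : ℝ) :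
    (fun t : ℝ => exp (-t / n)) '' Ioo 0 b = Ioo (exp (-b / n)) 1 := by
  ext r
  simp only [mem_image, mem_Ioo]
  constructor
  · rintro ⟨t, ⟨h0, hb⟩, rfl⟩
    refine ⟨exp_lt_exp.2 (by gcongr), exp_lt_one_iff.2 ?_⟩
    rw [neg_div]
    linarith [div_pos h0 hn]
  · rintro ⟨h0, h1⟩
    have hr : 0 < r := (exp_pos _).trans h0
    refine ⟨-(n * log r), ⟨?_, ?_⟩, ?_⟩
    · linarith [mul_neg_of_pos_of_neg hn (log_neg hr h1)]
    · have := (lt_log_iff_exp_lt hr).2 h0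
      rw [div_lt_iff₀ hn] at this
      linarith
    · rw [neg_neg, mul_div_cancel_left₀ _ hn.ne', exp_log hr]

/-- The substitution `t ↦ e^{-t/n}` maps `(0, ∞)` onto `(0, 1)`. -/
lemma image_exp_neg_div_Ioi {n : ℝ} (hn : 0 < n) :
    (fun t : ℝ => exp (-t / n)) '' Ioi 0 = Ioo 0 1 := by
  ext r
  simp only [mem_image, mem_Ioo, mem_Ioi]
  constructor
  · rintro ⟨t, h0, rfl⟩
    refine ⟨exp_pos _, exp_lt_one_iff.2 ?_⟩
    rw [neg_div]
    linarith [div_pos h0 hn]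
  · rintro ⟨hr, h1⟩
    refine ⟨-(n * log r), ?_, ?_⟩
    · linarith [mul_neg_of_pos_of_neg hn (log_neg hr h1)]
    · rw [neg_neg, mul_div_cancel_left₀ _ hn.ne', exp_log hr]

lemma hasDerivWithinAt_exp_neg_div (n t : ℝ) (s : Set ℝ) :
    HasDerivWithinAt (fun t : ℝ => exp (-t / n)) (-(exp (-t / n) / n)) s t := by
  have h := ((hasDerivAt_neg t).div_const n).exp
  rw [show -(exp (-t / n) / n) = exp (-t / n) * (-1 / n) by ring]
  exact h.hasDerivWithinAt

lemma injOn_exp_neg_div {n : ℝ} (hn : 0 < n) (s : Set ℝ) :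
    InjOn (fun t : ℝ => exp (-t / n)) s := by
  intro x _ y _ h
  have h2 := exp_injective h
  rw [div_left_inj' hn.ne'] at h2
  linarith

lemma abs_neg_exp_div {n : ℝ} (hn : 0 < n) (t : ℝ) :
    |-(exp (-t / n) / n)| = exp (-t / n) / n := by
  rw [abs_neg, abs_of_pos (div_pos (exp_pos _) hn)]

lemma integrableOn_comp_exp_neg_div_Ioi {n : ℝ} (hn : 0 < n) (G : ℝ → ℝ) :
    IntegrableOn G (Ioo 0 1) ↔
      IntegrableOn (fun t => exp (-t / n) / n * G (exp (-t / n))) (Ioi 0) := by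
  have h := integrableOn_image_iff_integrableOn_abs_deriv_smul measurableSet_Ioi
    (fun t _ => hasDerivWithinAt_exp_neg_div n t (Ioi 0)) (injOn_exp_neg_div hn _) G
  rw [image_exp_neg_div_Ioi hn] at h
  simpa only [abs_neg_exp_div hn, smul_eq_mul] using h

lemma integral_comp_exp_neg_div_Ioo {n : ℝ} (hn : 0 < n) (G : ℝ → ℝ) (b : ℝ) :
    ∫ r in Ioo (exp (-b / n)) 1, G r = ∫ t in Ioo 0 b, exp (-t / n) / n * G (exp (-t / n)) := by
  have h := integral_image_eq_integral_abs_deriv_smul measurableSet_Ioo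
    (fun t _ => hasDerivWithinAt_exp_neg_div n t (Ioo 0 b)) (injOn_exp_neg_div hn _) G
  rw [image_exp_neg_div_Ioo hn] at h
  simpa only [abs_neg_exp_div hn, smul_eq_mul] using h

lemma lintegral_comp_exp_neg_div_Ioi {n : ℝ} (hn : 0 < n) (G : ℝ → ℝ≥0∞) :
    ∫⁻ r in Ioo 0 1, G r =
      ∫⁻ t in Ioi 0, ENNReal.ofReal (exp (-t / n) / n) * G (exp (-t / n)) := by
  have h := lintegral_image_eq_lintegral_abs_deriv_mul measurableSet_Ioi
    (fun t _ => hasDerivWithinAt_exp_neg_div n t (Ioi 0)) (injOn_exp_neg_div hn _) G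
  rw [image_exp_neg_div_Ioi hn] at h
  simpa only [abs_neg_exp_div hn] using h

lemma MemX1.aestronglyMeasurable_deriv {N k : ℕ} {v v' : ℝ → ℝ} (h : MemX1 N k v v') :
    AEStronglyMeasurable v' (volume.restrict (Ioo 0 1)) := by
  have hpos : ∀ j : ℕ, (0:ℝ) < 1 / ((j:ℝ) + 2) := fun j => by positivity
  have hhalf : ∀ j : ℕ, 1 / ((j:ℝ) + 2) < 1 := fun j => by
    rw [div_lt_one (by positivity)]
    linarith [(Nat.cast_nonneg j : (0:ℝ) ≤ j)]
  have hlim : Tendsto (fun j : ℕ => 1 / ((j:ℝ) + 2)) atTop (nhds 0) :=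
    tendsto_const_nhds.div_atTop
      (tendsto_atTop_add_const_right _ _ tendsto_natCast_atTop_atTop)
  have hlim' : Tendsto (fun j : ℕ => 1 - 1 / ((j:ℝ) + 2)) atTop (nhds 1) := by
    simpa using tendsto_const_nhds.sub hlim
  refine (aecover_Ioo_of_Ioc (μ := volume) hlim hlim').aestronglyMeasurable fun j => ?_
  have hint := (h.locAC _ ⟨hpos j, hhalf j⟩ (1 - 1 / ((j:ℝ) + 2))
    ⟨by linarith [hhalf j], by linarith [hpos j]⟩).1
  exact hint.1.aestronglyMeasurable.mono_measure
    (Measure.restrict_mono le_rfl Measure.restrict_le_self)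

lemma MemX1.integrableOn_grad {N k : ℕ} {v v' : ℝ → ℝ} (h : MemX1 N k v v') :
    IntegrableOn (fun r => r ^ (N - k) * |v' r| ^ (k + 1)) (Ioo 0 1) := by
  have hm : AEStronglyMeasurable (fun r => r ^ (N - k) * |v' r| ^ (k + 1))
      (volume.restrict (Ioo 0 1)) := by
    have h1 := h.aestronglyMeasurable_deriv.norm.pow (k + 1)
    exact ((continuous_pow (N - k)).aestronglyMeasurable).mul h1
  refine (lintegral_ofReal_ne_top_iff_integrable hm ?_).1 h.grad_int.ne
  filter_upwards [ae_restrict_mem measurableSet_Ioo] with r hr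
  have := hr.1
  positivity

lemma MemX1.abs_le_integral {N k : ℕ} {v v' : ℝ → ℝ} (h : MemX1 N k v v') {r : ℝ}
    (hr : r ∈ Ioo (0:ℝ) 1) (hint : IntegrableOn v' (Ioo r 1)) :
    |v r| ≤ ∫ x in Ioo r 1, |v' x| := by
  have hev : ∀ᶠ b in nhdsWithin (1:ℝ) (Iio 1), |v r| ≤ |v b| + ∫ x in Ioo r 1, |v' x| := by
    filter_upwards [Ioo_mem_nhdsLT hr.2] with b hb
    have h1 := (h.locAC r hr b ⟨hr.1.trans hb.1, hb.2⟩).2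
    have h2 : |∫ t in r..b, v' t| ≤ ∫ t in r..b, |v' t| :=
      intervalIntegral.abs_integral_le_integral_abs hb.1.le
    have h3 : ∫ t in r..b, |v' t| ≤ ∫ x in Ioo r 1, |v' x| := by
      rw [intervalIntegral.integral_of_le hb.1.le]
      exact setIntegral_mono_set hint.abs (ae_of_all _ fun _ => abs_nonneg _)
        (Filter.Eventually.of_forall fun x hx => ⟨hx.1, hx.2.trans_lt hb.2⟩)
    have h4 : |v r| ≤ |v b| + |v b - v r| := by
      have := abs_sub (v b) (v b - v r)
      simpa using this
    rw [h1] at h4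
    linarith
  have hlim : Tendsto (fun b => |v b| + ∫ x in Ioo r 1, |v' x|) (nhdsWithin (1:ℝ) (Iio 1))
      (nhds (∫ x in Ioo r 1, |v' x|)) := by
    simpa using (h.lim_one.abs).add_const (∫ x in Ioo r 1, |v' x|)
  exact ge_of_tendsto hlim hev

lemma omegaS_nonneg (N : ℕ) : 0 ≤ omegaS N :=
  mul_nonneg (Nat.cast_nonneg N) ENNReal.toReal_nonneg

lemma cN_nonneg (N k : ℕ) : 0 ≤ cN N k :=
  div_nonneg (mul_nonneg (omegaS_nonneg N) (Nat.cast_nonneg _)) (Nat.cast_nonneg N)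

lemma muN_eq {N k : ℕ} (hk : 0 < k) (hN : N = 2 * k) :
    muN N k = N * cN N k ^ (1 / k : ℝ) := by
  obtain ⟨m, rfl⟩ : ∃ m, k = m + 1 := ⟨k - 1, by omega⟩
  obtain ⟨M, rfl⟩ : ∃ M, N = M + 1 := ⟨N - 1, by omega⟩
  have hchoose : ((M + 1 : ℕ) : ℝ) * (M.choose m) = (M + 1).choose (m + 1) * ((m + 1 : ℕ) : ℝ) := by
    exact_mod_cast Nat.add_one_mul_choose_eq M m
  have hM : ((M + 1 : ℕ) : ℝ) ≠ 0 := by positivity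
  have hm : ((m + 1 : ℕ) : ℝ) ≠ 0 := by positivity
  have hexp : (2 : ℝ) / ((M + 1 : ℕ) : ℝ) = 1 / ((m + 1 : ℕ) : ℝ) := by
    rw [hN]
    push_cast
    field_simp
  have hbase : omegaS (M + 1) * (M.choose m) / ((m + 1 : ℕ) : ℝ) = cN (M + 1) (m + 1) := by
    rw [cN, div_eq_div_iff hm hM, mul_assoc, mul_assoc, mul_comm (M.choose m : ℝ), hchoose]
  rw [muN, hexp]
  simp only [Nat.add_sub_cancel]
  rw [hbase]

/-- In the variable `t = -N log r` a function in `X₁` becomes a profile controlled by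
the primitive of some `f ≥ 0` for which `∫ f ^ (k + 1)` is the normalised energy. -/
lemma MemX1.exists_profile {N k : ℕ} {v v' : ℝ → ℝ} (hk : 0 < k) (hN : N = 2 * k)
    (h : MemX1 N k v v') (hc : 0 < cN N k) :
    ∃ f : ℝ → ℝ, (∀ t, 0 ≤ f t) ∧ (∀ a b, IntervalIntegrable f volume a b) ∧
      (∀ a b, IntervalIntegrable (fun t => f t ^ (k + 1)) volume a b) ∧
      (∀ b, 0 ≤ b → ∫ t in 0..b, f t ^ (k + 1) =
        cN N k * ∫ r in Ioo (exp (-b / N)) 1, r ^ (N - k) * |v' r| ^ (k + 1)) ∧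
      (∀ t, 0 < t → muN N k * |v (exp (-t / N))| ^ (((N : ℝ) + 2) / N) ≤
        (∫ s in 0..t, f s) ^ (1 + 1 / k : ℝ)) := by
  have hn : (0:ℝ) < N := by
    have : 0 < N := by omega
    exact_mod_cast this
  have hkr : (0:ℝ) < k := by exact_mod_cast hk
  have hNk : N - k = k := by omega
  set c := cN N k with hcdef
  set C : ℝ := (c / N) ^ (1 / ((k + 1 : ℕ) : ℝ)) with hC
  have hC0 : 0 ≤ C := rpow_nonneg (div_nonneg hc.le hn.le) _
  have hCpow : C ^ (k + 1) = c / N :=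
    rpow_one_div_natCast_pow k.succ_pos (div_nonneg hc.le hn.le)
  set φ : ℝ → ℝ := fun t => exp (-t / N) with hφ
  set F : ℝ → ℝ := fun t => C * |v' (φ t)| * φ t with hF
  have hF0 : ∀ t, 0 ≤ F t := fun t => by
    have : 0 < φ t := exp_pos _
    positivity
  set g : ℝ → ℝ := fun r => r ^ (N - k) * |v' r| ^ (k + 1) with hg
  have hFpow : ∀ t, F t ^ (k + 1) = c * (φ t / N * g (φ t)) := fun t => by
    simp only [hF, hg, hNk, mul_pow, hCpow]
    ring
  set f : ℝ → ℝ := (Ioi (0:ℝ)).indicator F with hf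
  have hf0 : ∀ t, 0 ≤ f t := fun t => indicator_nonneg (fun x _ => hF0 x) t
  have hfpow : (fun t => f t ^ (k + 1)) = (Ioi (0:ℝ)).indicator (fun t => F t ^ (k + 1)) := by
    ext t
    by_cases ht : t ∈ Ioi (0:ℝ)
    · simp [hf, ht]
    · simp [hf, ht]
  have hfpint : Integrable (fun t => f t ^ (k + 1)) := by
    rw [hfpow, integrable_indicator_iff measurableSet_Ioi]
    simp only [hFpow]
    exact ((integrableOn_comp_exp_neg_div_Ioi hn g).1 h.integrableOn_grad).const_mul c
  have hfmeas : AEStronglyMeasurable f volume := by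
    have h1 := (hfpint.aemeasurable.pow_const (1 / ((k + 1 : ℕ) : ℝ))).aestronglyMeasurable
    refine h1.congr (Filter.Eventually.of_forall fun t => ?_)
    simp only [one_div]
    exact pow_rpow_inv_natCast (hf0 t) k.succ_ne_zero
  have hfint : ∀ a b, IntervalIntegrable f volume a b := fun a b => by
    have h1 : IntervalIntegrable (fun t => 1 + f t ^ (k + 1)) volume a b :=
      intervalIntegrable_const.add hfpint.intervalIntegrable
    refine h1.mono_fun hfmeas.restrict (Filter.Eventually.of_forall fun t => ?_)
    have h2 : 0 ≤ f t ^ (k + 1) := pow_nonneg (hf0 t) _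
    simp only [norm_eq_abs]
    rw [abs_of_nonneg (hf0 t), abs_of_nonneg (by linarith)]
    rcases le_total (f t) 1 with h3 | h3
    · linarith
    · have h4 : f t ≤ f t ^ (k + 1) := le_self_pow₀ h3 k.succ_ne_zero
      linarith
  have hint_eq : ∀ (G : ℝ → ℝ) (b : ℝ), 0 ≤ b →
      ∫ t in 0..b, (Ioi (0:ℝ)).indicator G t = ∫ t in Ioo 0 b, G t := fun G b hb => by
    rw [intervalIntegral.integral_of_le hb, integral_Ioc_eq_integral_Ioo]
    exact setIntegral_congr_fun measurableSet_Ioo fun t ht => indicator_of_mem (mem_Ioi.2 ht.1) G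
  refine ⟨f, hf0, hfint, fun a b => hfpint.intervalIntegrable, fun b hb => ?_, fun t ht => ?_⟩
  · rw [hfpow, hint_eq _ b hb, integral_comp_exp_neg_div_Ioo hn, ← integral_const_mul]
    simp only [hFpow, hφ, hg]
  · have hFeq : ∀ s, F s = C * N * (φ s / N * |v' (φ s)|) := fun s => by
      simp only [hF]
      field_simp
    have hφt : φ t ∈ Ioo (0:ℝ) 1 := by
      rw [← image_exp_neg_div_Ioi hn]
      exact mem_image_of_mem _ ht
    have hv'meas : AEStronglyMeasurable v' (volume.restrict (Ioo (φ t) 1)) :=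
      h.aestronglyMeasurable_deriv.mono_measure
        (Measure.restrict_mono (Ioo_subset_Ioo_left hφt.1.le) le_rfl)
    have hgrad : ∀ r ∈ Ioo (φ t) 1, ‖v' r‖ ≤ 1 + ((φ t) ^ (N - k))⁻¹ * g r := fun r hr => by
      have hp : 0 < (φ t) ^ (N - k) := pow_pos hφt.1 _
      have h1 : (φ t) ^ (N - k) * |v' r| ^ (k + 1) ≤ g r := by
        simp only [hg]
        gcongr
        exact hr.1.le
      have h2 : |v' r| ^ (k + 1) ≤ ((φ t) ^ (N - k))⁻¹ * g r := by
        rwa [← div_eq_inv_mul, le_div_iff₀' hp]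
      rw [norm_eq_abs]
      rcases le_total |v' r| 1 with h3 | h3
      · linarith [pow_nonneg (abs_nonneg (v' r)) (k + 1)]
      · have h4 : |v' r| ≤ |v' r| ^ (k + 1) := le_self_pow₀ h3 k.succ_ne_zero
        linarith
    have hv'int : IntegrableOn v' (Ioo (φ t) 1) := by
      have h1 : IntegrableOn (fun r => 1 + ((φ t) ^ (N - k))⁻¹ * g r) (Ioo (φ t) 1) :=
        (integrableOn_const (by simp)).add
          ((h.integrableOn_grad.mono_set (Ioo_subset_Ioo_left hφt.1.le)).const_mul _)
      refine Integrable.mono' h1 hv'meas ?_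
      filter_upwards [ae_restrict_mem measurableSet_Ioo] with r hr using hgrad r hr
    have hval : ∫ s in 0..t, f s = C * N * ∫ r in Ioo (φ t) 1, |v' r| := by
      rw [hf, hint_eq _ t ht.le, integral_comp_exp_neg_div_Ioo hn, ← integral_const_mul]
      simp only [hFeq, hφ]
    have hvle : C * N * |v (φ t)| ≤ ∫ s in 0..t, f s := by
      rw [hval]
      exact mul_le_mul_of_nonneg_left (h.abs_le_integral hφt hv'int) (mul_nonneg hC0 hn.le)
    have hexp : ((N : ℝ) + 2) / N = 1 + 1 / k := by
      rw [hN]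
      push_cast
      field_simp
    have hconst : (C * N) ^ (1 + 1 / k : ℝ) = muN N k := by
      have hCN : 0 ≤ C * N := mul_nonneg hC0 hn.le
      have hmu : 0 ≤ muN N k := by
        rw [muN_eq hk hN]
        exact mul_nonneg hn.le (rpow_nonneg hc.le _)
      refine (pow_left_inj₀ (rpow_nonneg hCN _) hmu hk.ne').1 ?_
      rw [rpow_one_add_one_div_pow hk hCN, muN_eq hk hN, mul_pow, mul_pow,
        rpow_one_div_natCast_pow hk hc.le, hCpow, pow_succ (N : ℝ) k]
      field_simp
    rw [hexp, ← hconst, ← mul_rpow (mul_nonneg hC0 hn.le) (abs_nonneg _)]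
    exact rpow_le_rpow (mul_nonneg (mul_nonneg hC0 hn.le) (abs_nonneg _)) hvle (by positivity)

/-- The normalisation forces `c_N > 0` and turns into an identity for the energy. -/
lemma energy_eq_one_of_normX1_eq_one {N k : ℕ} {v' : ℝ → ℝ} (h : normX1 N k v' = 1) :
    cN N k * ∫ r in Ioo (0:ℝ) 1, r ^ (N - k) * |v' r| ^ (k + 1) = 1 := by
  have hI : 0 ≤ ∫ r in Ioo (0:ℝ) 1, r ^ (N - k) * |v' r| ^ (k + 1) :=
    setIntegral_nonneg measurableSet_Ioo fun r hr => by
      have := hr.1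
      positivity
  have hexp : (1 / (k + 1 : ℝ)) ≠ 0 := by positivity
  exact (rpow_left_inj (mul_nonneg (cN_nonneg N k) hI) zero_le_one hexp).1
    (h.trans (one_rpow _).symm)

/-- Bounds on `(0, b]` that are uniform in `b` pass to `(0, ∞)`. -/
lemma lintegral_Ioi_ofReal_le_of_forall {G : ℝ → ℝ} {A M : ℝ} (hG : ∀ t, 0 ≤ G t)
    (hint : ∀ b, IntervalIntegrable G volume 0 b)
    (hM : ∀ b, 0 ≤ b → A ≤ b → ∫ t in 0..b, G t ≤ M) :
    ∫⁻ t in Ioi (0:ℝ), ENNReal.ofReal (G t) ≤ ENNReal.ofReal M := by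
  have hmeas : AEMeasurable (fun t => ENNReal.ofReal (G t)) (volume.restrict (Ioi (0:ℝ))) := by
    refine AEMeasurable.ennreal_ofReal ?_
    have hcov : AECover (volume.restrict (Ioi (0:ℝ))) atTop (fun j : ℕ => Iic (j : ℝ)) :=
      (aecover_Iic tendsto_natCast_atTop_atTop).restrict
    refine hcov.aemeasurable fun j => ?_
    rw [Measure.restrict_restrict measurableSet_Iic, inter_comm, Ioi_inter_Iic]
    exact (hint j).1.aemeasurable
  have hcov : AECover (volume.restrict (Ioi (0:ℝ))) atTop (fun b : ℝ => Iic b) :=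
    (aecover_Iic tendsto_id).restrict
  refine le_of_tendsto (hcov.lintegral_tendsto_of_countably_generated hmeas) ?_
  filter_upwards [eventually_ge_atTop 0, eventually_ge_atTop A] with b hb hAb
  rw [Measure.restrict_restrict measurableSet_Iic, inter_comm, Ioi_inter_Iic,
    ← ofReal_integral_eq_lintegral_ofReal (hint b).1 (ae_of_all _ hG),
    ← intervalIntegral.integral_of_le hb]
  exact ENNReal.ofReal_le_ofReal (hM b hb hAb)

/-- The functional in the variable `t`, bounded in terms of a profile. -/
lemma lintegral_exp_le_of_profile {N k : ℕ} (hk : 0 < k) (hN : N = 2 * k) {v f : ℝ → ℝ}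
    {A M : ℝ} (hfint : ∀ a b, IntervalIntegrable f volume a b)
    (hv : ∀ t, 0 < t → muN N k * |v (exp (-t / N))| ^ (((N : ℝ) + 2) / N) ≤
        (∫ s in 0..t, f s) ^ (1 + 1 / k : ℝ))
    (hM : ∀ b, A ≤ b → ∫ t in 0..b, exp ((∫ s in 0..t, f s) ^ (1 + 1 / k : ℝ) - t) ≤ M) :
    ∫⁻ r in Ioo (0:ℝ) 1,
        ENNReal.ofReal (r ^ (N - 1) * exp (muN N k * |v r| ^ (((N : ℝ) + 2) / N))) ≤
      ENNReal.ofReal ((1 / N) * M) := by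
  have hNpos : 0 < N := by omega
  have hn : (0:ℝ) < N := by exact_mod_cast hNpos
  have hcont : Continuous fun t : ℝ => exp ((∫ s in 0..t, f s) ^ (1 + 1 / k : ℝ) - t) := by
    have h1 : Continuous fun t : ℝ => ∫ s in 0..t, f s :=
      intervalIntegral.continuous_primitive hfint 0
    have h2 : (0:ℝ) ≤ 1 + 1 / k := by positivity
    exact ((h1.rpow_const fun _ => Or.inr h2).sub continuous_id).rexp
  rw [lintegral_comp_exp_neg_div_Ioi hn]
  calc
    _ ≤ ∫⁻ t in Ioi (0:ℝ), ENNReal.ofReal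
          ((1 / N) * exp ((∫ s in 0..t, f s) ^ (1 + 1 / k : ℝ) - t)) := by
        refine setLIntegral_mono' measurableSet_Ioi fun t ht => ?_
        have hφ : 0 < exp (-t / N) := exp_pos _
        rw [← ENNReal.ofReal_mul (div_pos hφ hn).le]
        refine ENNReal.ofReal_le_ofReal ?_
        have hpow : exp (-t / N) * exp (-t / N) ^ (N - 1) = exp (-t) := by
          rw [← pow_succ', Nat.sub_add_cancel hNpos, ← exp_nat_mul, mul_div_cancel₀ _ hn.ne']
        have h1 := exp_le_exp.2 (hv t ht)
        rw [sub_eq_add_neg, exp_add]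
        calc
          _ = (1 / N) * (exp (muN N k * |v (exp (-t / N))| ^ (((N : ℝ) + 2) / N)) *
                (exp (-t / N) * exp (-t / N) ^ (N - 1))) := by ring
          _ ≤ _ := by
            rw [hpow]
            gcongr
    _ ≤ _ := by
        refine lintegral_Ioi_ofReal_le_of_forall (A := A) (fun t => by positivity)
          (fun b => (continuous_const.mul hcont).intervalIntegrable 0 b) fun b _ hAb => ?_
        rw [intervalIntegral.integral_const_mul]
        exact mul_le_mul_of_nonneg_left (hM b hAb) (by positivity)

theorem stmt7 (N k : ℕ) (hk : 0 < k) (hN : N = 2 * k) (v v' : ℕ → ℝ → ℝ)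
    (hmem : ∀ j, MemX1 N k (v j) (v' j)) (hnorm : ∀ j, normX1 N k (v' j) = 1)
    (hweak : WeakConvX1 N k v' (fun _ => 0))
    (hconc : ∀ r₀ ∈ Ioo (0:ℝ) 1,
      Tendsto (fun j => ∫ r in Ioo r₀ 1, r ^ (N - k) * |v' j r| ^ (k + 1)) atTop (nhds 0)) :
    limsup (fun j => ∫⁻ r in Ioo (0:ℝ) 1,
        ENNReal.ofReal (r ^ (N - 1) * exp (muN N k * |v j r| ^ (((N : ℝ) + 2) / N)))) atTop ≤
      ENNReal.ofReal (((1 : ℝ) / N) * (1 + exp (∑ i ∈ Finset.range k, (1 : ℝ) / (i + 1)))) := by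
  have hNpos : 0 < N := by omega
  have hn : (0:ℝ) < N := by exact_mod_cast hNpos
  have henergy : ∀ j, cN N k * ∫ r in Ioo (0:ℝ) 1, r ^ (N - k) * |v' j r| ^ (k + 1) = 1 :=
    fun j => energy_eq_one_of_normX1_eq_one (hnorm j)
  have hc : 0 < cN N k := by
    refine (cN_nonneg N k).lt_of_ne fun h0 => ?_
    have := henergy 0
    rw [← h0, zero_mul] at this
    exact zero_ne_one this
  set S : ℝ := 1 + exp (∑ i ∈ Finset.range k, (1 : ℝ) / (i + 1)) with hS
  have key : ∀ ε > 0, limsup (fun j => ∫⁻ r in Ioo (0:ℝ) 1,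
      ENNReal.ofReal (r ^ (N - 1) * exp (muN N k * |v j r| ^ (((N : ℝ) + 2) / N)))) atTop ≤
      ENNReal.ofReal ((1 / N) * (S + ε)) := fun ε hε => by
    obtain ⟨A, hA, σ, hσ, hcore⟩ := exists_integral_exp_le hk hε
    have hr₀ : exp (-A / N) ∈ Ioo (0:ℝ) 1 := by
      rw [← image_exp_neg_div_Ioi hn]
      exact mem_image_of_mem _ hA
    have hlim : Tendsto (fun j => cN N k *
        ∫ r in Ioo (exp (-A / N)) 1, r ^ (N - k) * |v' j r| ^ (k + 1)) atTop (nhds 0) := by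
      simpa using (hconc _ hr₀).const_mul (cN N k)
    refine limsup_le_of_le (h := ?_)
    filter_upwards [hlim.eventually_le_const hσ] with j hj
    obtain ⟨f, hf0, hfint, hfpint, hfe, hfv⟩ := (hmem j).exists_profile hk hN hc
    refine lintegral_exp_le_of_profile hk hN hfint hfv
      (hcore f hf0 hfint hfpint (fun b hb => ?_) ?_)
    · rw [hfe b hb]
      refine le_of_le_of_eq ?_ (henergy j)
      refine mul_le_mul_of_nonneg_left (setIntegral_mono_set (hmem j).integrableOn_grad ?_ ?_)
        hc.le
      · filter_upwards [ae_restrict_mem measurableSet_Ioo] with r hr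
        have := hr.1
        simp only [Pi.zero_apply]
        positivity
      · exact (Ioo_subset_Ioo_left (exp_pos _).le).eventuallyLE
    · rw [hfe A hA.le]
      exact hj
  have hlim : Tendsto (fun ε : ℝ => ENNReal.ofReal ((1 / N) * (S + ε)))
      (nhdsWithin 0 (Ioi 0)) (nhds (ENNReal.ofReal ((1 / N) * S))) := by
    refine ENNReal.tendsto_ofReal (tendsto_nhdsWithin_of_tendsto_nhds ?_)
    have : Continuous fun ε : ℝ => (1 / (N : ℝ)) * (S + ε) := by fun_prop
    simpa using this.tendsto 0
  refine ge_of_tendsto hlim ?_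
  filter_upwards [self_mem_nhdsWithin] with ε hε using key ε hε
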